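/- Let A be a differential graded algebra over a ground ring k (a finite direct sum of copies of F_2), let M be a strictly unital right A-infinity module over A that is bounded (there exists N such that m_{j+1} = 0 for all j ≥ N), and let (X, δ^1) be a left type D structure over A. Define δ^j: X → A^{⊗j} ⊗ X by iterating δ^1 (δ^0 = id), and define ∂ on M ⊗_k X by ∂(p ⊗ x) = Σ_{j≥0} (m_{j+1} ⊗ id_X)(p ⊗ δ^j(x)) (a finite sum by boundedness). Then ∂ ∘ ∂ = 0, i.e., the box tensor product M ⊠ X is a chain complex. -/

import Mathlib

open TensorProduct LinearMap

noncomputable section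

/-- The `n`-fold tensor power `A^{⊗n}` over `R`. -/
abbrev TP (R : Type) [CommRing R] (A : Type) [AddCommGroup A] [Module R A] (n : ℕ) : Type :=
  PiTensorProduct R (fun _ : Fin n => A)

variable (R : Type) [CommRing R] (A : Type) [AddCommGroup A] [Module R A]

/-- Splitting `A^{⊗(j+k)} ≅ A^{⊗j} ⊗ A^{⊗k}`. -/
def splitTP (j k : ℕ) : TP R A (j + k) ≃ₗ[R] (TP R A j ⊗[R] TP R A k) :=
  (PiTensorProduct.reindex R (fun _ : Fin (j + k) => A) finSumFinEquiv.symm).trans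
    (PiTensorProduct.tmulEquiv R A).symm

/-- Splitting off the first `j` tensor factors: `A^{⊗n} ≅ A^{⊗j} ⊗ A^{⊗(n−j)}`. -/
def splitAt (n j : ℕ) (h : j ≤ n) : TP R A n ≃ₗ[R] (TP R A j ⊗[R] TP R A (n - j)) :=
  (PiTensorProduct.reindex R (fun _ : Fin n => A)
      (finCongr (by omega : n = j + (n - j)))).trans (splitTP R A j (n - j))

/-- `A^{⊗1} ≅ A`. -/
def oneEquivTP : TP R A 1 ≃ₗ[R] A :=
  PiTensorProduct.subsingletonEquiv (0 : Fin 1)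

/-- `A^{⊗0} ≅ R`. -/
def emptyEquivTP : TP R A 0 ≃ₗ[R] R :=
  PiTensorProduct.isEmptyEquiv (Fin 0)

/-- The multiplication `μ₂ : A^{⊗2} → A^{⊗1}`. -/
def mu2TP (mul : A →ₗ[R] A →ₗ[R] A) : TP R A 2 →ₗ[R] TP R A 1 :=
  (oneEquivTP R A).symm.toLinearMap ∘ₗ TensorProduct.lift mul ∘ₗ
    (TensorProduct.congr (oneEquivTP R A) (oneEquivTP R A)).toLinearMap ∘ₗ
    (splitTP R A 1 1).toLinearMap

/-- The `μ₁`-part of the bar differential on `A^{⊗n}`: the sum over all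
positions of applying the differential `dA` at that position. -/
def dbarTP (dA : A →ₗ[R] A) (n : ℕ) : TP R A n →ₗ[R] TP R A n :=
  ∑ i : Fin n,
    PiTensorProduct.map (Function.update (fun _ : Fin n => (LinearMap.id : A →ₗ[R] A)) i dA)

/-- Contraction `A^{⊗n} → A^{⊗(n−1)}` multiplying the adjacent tensor factors
in positions `i+1` and `i+2` (so `i + 2 ≤ n`). -/
def conTP (mul : A →ₗ[R] A →ₗ[R] A) (n i : ℕ) (h : i + 2 ≤ n) :
    TP R A n →ₗ[R] TP R A (n - 1) :=
  (PiTensorProduct.reindex R (fun _ : Fin (i + (1 + (n - i - 2))) => A)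
      (finCongr (by omega : i + (1 + (n - i - 2)) = n - 1))).toLinearMap ∘ₗ
  (splitTP R A i (1 + (n - i - 2))).symm.toLinearMap ∘ₗ
  lTensor (TP R A i) (splitTP R A 1 (n - i - 2)).symm.toLinearMap ∘ₗ
  lTensor (TP R A i) (rTensor (TP R A (n - i - 2)) (mu2TP R A mul)) ∘ₗ
  lTensor (TP R A i) (splitAt R A (n - i) 2 (by omega)).toLinearMap ∘ₗ
  (splitAt R A n i (by omega)).toLinearMap

/-- Insertion of the unit `1 ∈ A` after the first `k` tensor factors:
`A^{⊗N} → A^{⊗(N+1)}`. -/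
def insTP (one : A) (N k : ℕ) (h : k ≤ N) : TP R A N →ₗ[R] TP R A (N + 1) :=
  (PiTensorProduct.reindex R (fun _ : Fin (k + (1 + (N - k))) => A)
      (finCongr (by omega : k + (1 + (N - k)) = N + 1))).toLinearMap ∘ₗ
  (splitTP R A k (1 + (N - k))).symm.toLinearMap ∘ₗ
  lTensor (TP R A k) (splitTP R A 1 (N - k)).symm.toLinearMap ∘ₗ
  lTensor (TP R A k)
    (TensorProduct.mk R (TP R A 1) (TP R A (N - k)) ((oneEquivTP R A).symm one)) ∘ₗ
  (splitAt R A N k h).toLinearMap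

variable (M : Type) [AddCommGroup M] [Module R M]

/-- The term `m_{n−j+1}∘(m_{j+1} ⊗ id^{⊗(n−j)})` of the `A∞`-structure
equation, acting on `M ⊗ A^{⊗n}`.  Here `mOp j : M ⊗ A^{⊗j} → M` denotes the
`A∞`-operation `m_{j+1}` with `j` algebra inputs. -/
def AinfTerm (mOp : (j : ℕ) → (M ⊗[R] TP R A j) →ₗ[R] M) (n j : ℕ) :
    (M ⊗[R] TP R A n) →ₗ[R] M :=
  if h : j ≤ n then
    mOp (n - j) ∘ₗ rTensor (TP R A (n - j)) (mOp j) ∘ₗ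
      (TensorProduct.assoc R M (TP R A j) (TP R A (n - j))).symm.toLinearMap ∘ₗ
      lTensor M (splitAt R A n j h).toLinearMap
  else 0

/-- The `μ₂`-terms of the `A∞`-structure equation on `M ⊗ A^{⊗n}`: the sum
over all adjacent pairs of algebra inputs of multiplying them and applying
`m_n`. -/
def CtermTP (mul : A →ₗ[R] A →ₗ[R] A)
    (mOp : (j : ℕ) → (M ⊗[R] TP R A j) →ₗ[R] M) (n : ℕ) :
    (M ⊗[R] TP R A n) →ₗ[R] M :=
  ∑ i : Fin (n - 1),
    mOp (n - 1) ∘ₗ lTensor M (conTP R A mul n i.val (by have := i.isLt; omega))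

variable (X : Type) [AddCommGroup X] [Module R X]

/-- The iterate `δ^j : X → A^{⊗j} ⊗ X` of a type `D` structure map
`δ¹ : X → A ⊗ X`, with `δ⁰ = id` and `δ^{j+1} = (id ⊗ δ¹)∘δ^j`. -/
def deltaIter (δ : X →ₗ[R] A ⊗[R] X) : (j : ℕ) → X →ₗ[R] (TP R A j ⊗[R] X)
  | 0 => rTensor X (emptyEquivTP R A).symm.toLinearMap ∘ₗ
      (TensorProduct.lid R X).symm.toLinearMap
  | (j + 1) =>
      rTensor X ((splitTP R A j 1).symm.toLinearMap ∘ₗ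
          lTensor (TP R A j) (oneEquivTP R A).symm.toLinearMap) ∘ₗ
        (TensorProduct.assoc R (TP R A j) A X).symm.toLinearMap ∘ₗ
        lTensor (TP R A j) δ ∘ₗ deltaIter δ j

/-- The `j`-th term `(m_{j+1} ⊗ id_X)∘(id_M ⊗ δ^j)` of the box tensor product
differential on `M ⊗ X`. -/
def boxTerm (mOp : (j : ℕ) → (M ⊗[R] TP R A j) →ₗ[R] M)
    (δ : X →ₗ[R] A ⊗[R] X) (j : ℕ) : (M ⊗[R] X) →ₗ[R] (M ⊗[R] X) :=
  rTensor X (mOp j) ∘ₗ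
    (TensorProduct.assoc R M (TP R A j) X).symm.toLinearMap ∘ₗ
    lTensor M (deltaIter R A X δ j)

end

section BoxTensor

open TensorProduct LinearMap

variable {R : Type} [CommRing R] {A : Type} [AddCommGroup A] [Module R A]

/-- Concatenation `A^{⊗j} ⊗ A^{⊗k} ≅ A^{⊗m}` for `j + k = m`. -/
noncomputable def catTP {j k m : ℕ} (h : j + k = m) : (TP R A j ⊗[R] TP R A k) ≃ₗ[R] TP R A m :=
  (splitTP R A j k).symm.trans
    (PiTensorProduct.reindex R (fun _ : Fin (j + k) => A) (finCongr h))

lemma splitTP_symm_tprod {j k : ℕ} (a : Fin j → A) (b : Fin k → A) :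
    (splitTP R A j k).symm (PiTensorProduct.tprod R a ⊗ₜ PiTensorProduct.tprod R b) =
      PiTensorProduct.tprod R (Fin.append a b) := by
  simp only [splitTP, LinearEquiv.trans_symm, LinearEquiv.symm_symm, LinearEquiv.trans_apply]
  rw [PiTensorProduct.tmulEquiv_apply]
  erw [PiTensorProduct.reindex_symm, PiTensorProduct.reindex_tprod]
  congr 1
  funext i
  refine Fin.addCases (fun i => ?_) (fun i => ?_) i <;> simp

lemma catTP_tprod {j k m : ℕ} (h : j + k = m) (a : Fin j → A) (b : Fin k → A) :
    catTP (R := R) h (PiTensorProduct.tprod R a ⊗ₜ PiTensorProduct.tprod R b) =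
      PiTensorProduct.tprod R (fun i => Fin.append a b (Fin.cast h.symm i)) := by
  subst h
  simp only [catTP, LinearEquiv.trans_apply, splitTP_symm_tprod]
  erw [PiTensorProduct.reindex_tprod]
  rfl

lemma oneEquivTP_symm_apply (a : A) :
    (oneEquivTP R A).symm a = PiTensorProduct.tprod R (fun _ : Fin 1 => a) := by
  rw [LinearEquiv.symm_apply_eq]
  simp [oneEquivTP]

lemma emptyEquivTP_symm_apply (r : R) :
    (emptyEquivTP R A).symm r = r • PiTensorProduct.tprod R (fun i : Fin 0 => i.elim0) := by
  rw [LinearEquiv.symm_apply_eq]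
  simp [emptyEquivTP]

lemma splitAt_eq {n j : ℕ} (h : j ≤ n) :
    splitAt R A n j h = (catTP (Nat.add_sub_cancel' h)).symm := by
  rfl

lemma TP_induction {n : ℕ} {p : TP R A n → Prop}
    (h : ∀ a : Fin n → A, p (PiTensorProduct.tprod R a))
    (hs : ∀ (r : R) x, p x → p (r • x)) (hadd : ∀ x y, p x → p y → p (x + y))
    (x : TP R A n) : p x :=
  PiTensorProduct.induction_on x (fun r a => hs r _ (h a)) hadd

lemma catTP_assoc {i j k ij jk m : ℕ} (h₁ : i + j = ij) (h₂ : ij + k = m) (h₃ : j + k = jk)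
    (h₄ : i + jk = m) (u : TP R A i) (v : TP R A j) (w : TP R A k) :
    catTP h₂ (catTP h₁ (u ⊗ₜ v) ⊗ₜ w) = catTP h₄ (u ⊗ₜ catTP h₃ (v ⊗ₜ w)) := by
  induction u using TP_induction with
  | hs r x hx => simp only [← smul_tmul', map_smul, hx]
  | hadd x y hx hy => simp only [add_tmul, map_add, hx, hy]
  | h a =>
  induction v using TP_induction with
  | hs r x hx => simp only [← smul_tmul', tmul_smul, map_smul, hx]
  | hadd x y hx hy => simp only [add_tmul, tmul_add, map_add, hx, hy]
  | h b =>
  induction w using TP_induction with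
  | hs r x hx => simp only [tmul_smul, map_smul, hx]
  | hadd x y hx hy => simp only [tmul_add, map_add, hx, hy]
  | h c =>
  subst h₁ h₂ h₃
  simp only [catTP_tprod]
  congr 1
  exact Fin.append_assoc a b c

/-- Prepending one factor: `A ⊗ A^{⊗r} → A^{⊗m}` for `1 + r = m`. -/
noncomputable def consTP {r m : ℕ} (h : 1 + r = m) : (A ⊗[R] TP R A r) →ₗ[R] TP R A m :=
  (catTP h).toLinearMap ∘ₗ rTensor (TP R A r) (oneEquivTP R A).symm.toLinearMap

lemma consTP_tmul {r m : ℕ} (h : 1 + r = m) (x : A) (w : TP R A r) :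
    consTP h (x ⊗ₜ[R] w) = catTP h ((oneEquivTP R A).symm x ⊗ₜ w) := by
  simp [consTP]

lemma splitTP_symm_eq (j k : ℕ) :
    (splitTP R A j k).symm = catTP rfl := by
  ext z
  simp only [catTP, LinearEquiv.trans_apply]
  erw [PiTensorProduct.reindex_refl]
  rfl

lemma catTP_empty {j : ℕ} (h : j + 0 = j) (u : TP R A j) :
    catTP h (u ⊗ₜ (emptyEquivTP R A).symm 1) = u := by
  induction u using TP_induction with
  | hs r x hx => simp only [← smul_tmul', map_smul, hx]
  | hadd x y hx hy => simp only [add_tmul, map_add, hx, hy]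
  | h a =>
  rw [emptyEquivTP_symm_apply, one_smul, catTP_tprod]
  congr 1
  funext i
  exact Fin.append_left a _ i

lemma empty_catTP {j : ℕ} (h : 0 + j = j) (u : TP R A j) :
    catTP h ((emptyEquivTP R A).symm 1 ⊗ₜ u) = u := by
  induction u using TP_induction with
  | hs r x hx => simp only [tmul_smul, map_smul, hx]
  | hadd x y hx hy => simp only [tmul_add, map_add, hx, hy]
  | h a =>
  rw [emptyEquivTP_symm_apply, one_smul, catTP_tprod]
  congr 1
  funext i
  have : Fin.cast h.symm i = Fin.natAdd 0 i := by ext; simp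
  rw [this, Fin.append_right]

lemma map_update_catTP (dA : A →ₗ[R] A) {i r s n : ℕ} (hs : 1 + r = s) (hn : i + s = n)
    (hi : i < n) :
    PiTensorProduct.map (Function.update (fun _ : Fin n => (LinearMap.id : A →ₗ[R] A)) ⟨i, hi⟩ dA)
        ∘ₗ (catTP hn).toLinearMap ∘ₗ lTensor (TP R A i) (consTP hs) =
      (catTP hn).toLinearMap ∘ₗ lTensor (TP R A i) (consTP hs ∘ₗ rTensor (TP R A r) dA) := by
  refine TensorProduct.ext' fun u y => ?_
  induction y using TensorProduct.induction_on with
  | zero => simp only [tmul_zero, map_zero]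
  | add x y hx hy => simp only [tmul_add, map_add, hx, hy]
  | tmul x w =>
  induction u using TP_induction with
  | hs r x hx => simp only [← smul_tmul', map_smul, hx]
  | hadd x y hx hy => simp only [add_tmul, map_add, hx, hy]
  | h a =>
  induction w using TP_induction with
  | hs r x hx => simp only [tmul_smul, map_smul, hx]
  | hadd x y hx hy => simp only [tmul_add, map_add, hx, hy]
  | h c =>
  subst hs hn
  simp only [LinearMap.comp_apply, LinearEquiv.coe_coe, lTensor_tmul, rTensor_tmul, consTP_tmul,
    oneEquivTP_symm_apply, catTP_tprod, PiTensorProduct.map_tprod]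
  congr 1
  funext k
  refine Fin.addCases (fun k => ?_) (fun k => ?_) k
  · rw [Function.update_of_ne (by simp [Fin.ext_iff]; omega)]
    simp
  · refine Fin.addCases (fun k => ?_) (fun k => ?_) k
    · obtain rfl : k = 0 := Subsingleton.elim _ _
      have : Fin.natAdd i (Fin.castAdd r (0 : Fin 1)) = ⟨i, hi⟩ := by ext; simp
      rw [this, Function.update_self, ← this]
      simp
    · rw [Function.update_of_ne (by simp [Fin.ext_iff])]
      simp

lemma mu2TP_catTP (mul : A →ₗ[R] A →ₗ[R] A) (x y : A) :
    mu2TP R A mul (catTP (rfl : 1 + 1 = 2)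
      ((oneEquivTP R A).symm x ⊗ₜ (oneEquivTP R A).symm y)) = (oneEquivTP R A).symm (mul x y) := by
  rw [← splitTP_symm_eq]
  simp [mu2TP]

lemma conTP_catTP (mul : A →ₗ[R] A →ₗ[R] A) {i r s t n : ℕ} (hs : 1 + r = s) (ht : 1 + s = t)
    (hn : i + t = n) (hn' : i + s = n - 1) (hi : i + 2 ≤ n) :
    conTP R A mul n i hi ∘ₗ (catTP hn).toLinearMap ∘ₗ
        lTensor (TP R A i) (consTP ht ∘ₗ lTensor A (consTP hs)) =
      (catTP hn').toLinearMap ∘ₗ lTensor (TP R A i) (consTP hs ∘ₗ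
        rTensor (TP R A r) (TensorProduct.lift mul) ∘ₗ
        (TensorProduct.assoc R A A (TP R A r)).symm.toLinearMap) := by
  refine TensorProduct.ext' fun u y => ?_
  induction y using TensorProduct.induction_on with
  | zero => simp only [tmul_zero, map_zero]
  | add x y hx hy => simp only [tmul_add, map_add, hx, hy]
  | tmul x y =>
  induction y using TensorProduct.induction_on with
  | zero => simp only [tmul_zero, map_zero]
  | add x y hx hy => simp only [tmul_add, map_add, hx, hy]
  | tmul y w =>
  obtain rfl : t = n - i := by omega
  obtain rfl : r = n - i - 2 := by omega
  subst hs
  have h2 : 2 + (n - i - 2) = n - i := by omega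
  have key : (splitAt R A (n - i) 2 (by omega))
      (catTP ht ((oneEquivTP R A).symm x ⊗ₜ catTP rfl ((oneEquivTP R A).symm y ⊗ₜ w))) =
      catTP (rfl : 1 + 1 = 2) ((oneEquivTP R A).symm x ⊗ₜ (oneEquivTP R A).symm y) ⊗ₜ w := by
    rw [splitAt_eq, LinearEquiv.symm_apply_eq]
    exact (catTP_assoc _ _ _ _ _ _ _).symm
  simp only [conTP, LinearMap.comp_apply, LinearEquiv.coe_coe, lTensor_tmul, rTensor_tmul,
    consTP_tmul, assoc_symm_tmul, lift.tmul]
  rw [splitAt_eq (show i ≤ n by omega), LinearEquiv.symm_apply_apply]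
  simp only [lTensor_tmul, LinearEquiv.coe_coe, key, rTensor_tmul, mu2TP_catTP]
  rw [splitTP_symm_eq 1]
  rfl

variable {X : Type} [AddCommGroup X] [Module R X]

section Glue

variable {B B' C C' C'' D D' : Type} [AddCommGroup B] [Module R B] [AddCommGroup B'] [Module R B']
  [AddCommGroup C] [Module R C] [AddCommGroup C'] [Module R C'] [AddCommGroup C''] [Module R C'']
  [AddCommGroup D] [Module R D] [AddCommGroup D'] [Module R D']

/-- Apply `f : X → C ⊗ X` to the second factor of `B ⊗ X` and combine the coefficients by
`g : B ⊗ C → D`. -/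
noncomputable def glue (g : B ⊗[R] C →ₗ[R] D) (f : X →ₗ[R] C ⊗[R] X) : B ⊗[R] X →ₗ[R] D ⊗[R] X :=
  rTensor X g ∘ₗ (TensorProduct.assoc R B C X).symm.toLinearMap ∘ₗ lTensor B f

lemma rTensor_comp_glue (h : D →ₗ[R] D') (g : B ⊗[R] C →ₗ[R] D) (f : X →ₗ[R] C ⊗[R] X) :
    rTensor X h ∘ₗ glue g f = glue (h ∘ₗ g) f := by
  simp only [glue, rTensor_comp, LinearMap.comp_assoc]

lemma glue_comp_rTensor (g : B ⊗[R] C →ₗ[R] D) (f : X →ₗ[R] C ⊗[R] X) (h : B' →ₗ[R] B) :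
    glue g f ∘ₗ rTensor X h = glue (g ∘ₗ rTensor C h) f := by
  refine TensorProduct.ext' fun b x => ?_
  simp only [glue, LinearMap.comp_apply, rTensor_tmul, lTensor_tmul, LinearEquiv.coe_coe]
  induction f x using TensorProduct.induction_on with
  | zero => simp only [tmul_zero, map_zero]
  | add x y hx hy => simp only [tmul_add, map_add, hx, hy]
  | tmul c x => simp

lemma glue_rTensor_comp (g : B ⊗[R] C →ₗ[R] D) (h : C' →ₗ[R] C) (f : X →ₗ[R] C' ⊗[R] X) :
    glue g (rTensor X h ∘ₗ f) = glue (g ∘ₗ lTensor B h) f := by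
  refine TensorProduct.ext' fun b x => ?_
  simp only [glue, LinearMap.comp_apply, lTensor_tmul, LinearEquiv.coe_coe]
  induction f x using TensorProduct.induction_on with
  | zero => simp only [tmul_zero, map_zero]
  | add x y hx hy => simp only [tmul_add, map_add, hx, hy]
  | tmul c x => simp

lemma glue_glue_comp (g : B ⊗[R] C →ₗ[R] D) (g' : C' ⊗[R] C'' →ₗ[R] C) (f : X →ₗ[R] C'' ⊗[R] X)
    (f' : X →ₗ[R] C' ⊗[R] X) :
    glue g (glue g' f ∘ₗ f') =
      glue (g ∘ₗ lTensor B g' ∘ₗ (TensorProduct.assoc R B C' C'').toLinearMap) f ∘ₗ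
        glue LinearMap.id f' := by
  refine TensorProduct.ext' fun b x => ?_
  simp only [glue, LinearMap.comp_apply, lTensor_tmul, LinearEquiv.coe_coe, rTensor_id,
    LinearMap.id_apply]
  induction f' x using TensorProduct.induction_on with
  | zero => simp only [tmul_zero, map_zero]
  | add x y hx hy => simp only [tmul_add, map_add, hx, hy]
  | tmul c x =>
  simp only [assoc_symm_tmul, lTensor_tmul]
  induction f x using TensorProduct.induction_on with
  | zero => simp only [tmul_zero, map_zero]
  | add x y hx hy => simp only [tmul_add, map_add, hx, hy]
  | tmul c x => simp

lemma glue_add_left (g g' : B ⊗[R] C →ₗ[R] D) (f : X →ₗ[R] C ⊗[R] X) :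
    glue (g + g') f = glue g f + glue g' f := by
  simp only [glue, rTensor_add, LinearMap.add_comp]

lemma glue_zero_left (f : X →ₗ[R] C ⊗[R] X) :
    glue (0 : B ⊗[R] C →ₗ[R] D) f = 0 := by
  simp [glue]

lemma glue_sum_left {ι : Type} (s : Finset ι) (g : ι → B ⊗[R] C →ₗ[R] D) (f : X →ₗ[R] C ⊗[R] X) :
    glue (∑ i ∈ s, g i) f = ∑ i ∈ s, glue (g i) f := by
  classical
  induction s using Finset.induction_on with
  | empty => simp [glue_zero_left]
  | insert a s ha ih => rw [Finset.sum_insert ha, Finset.sum_insert ha, glue_add_left, ih]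

end Glue

variable (δ : X →ₗ[R] A ⊗[R] X)

lemma deltaIter_zero_apply (x : X) :
    deltaIter R A X δ 0 x = (emptyEquivTP R A).symm 1 ⊗ₜ x := by
  simp [deltaIter]

lemma deltaIter_succ (j : ℕ) :
    deltaIter R A X δ (j + 1) =
      glue ((catTP (rfl : j + 1 = j + 1)).toLinearMap ∘ₗ
        lTensor (TP R A j) (oneEquivTP R A).symm.toLinearMap) δ ∘ₗ deltaIter R A X δ j := by
  rw [← splitTP_symm_eq]
  rfl

lemma deltaIter_one :
    deltaIter R A X δ 1 = rTensor X (oneEquivTP R A).symm.toLinearMap ∘ₗ δ := by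
  ext x
  rw [deltaIter_succ]
  simp only [glue, LinearMap.comp_apply, deltaIter_zero_apply, lTensor_tmul, LinearEquiv.coe_coe]
  induction δ x using TensorProduct.induction_on with
  | zero => simp only [tmul_zero, map_zero]
  | add x y hx hy => simp only [tmul_add, map_add, hx, hy]
  | tmul c x => simp [empty_catTP]

lemma deltaIter_add {j k m : ℕ} (h : j + k = m) :
    deltaIter R A X δ m =
      glue (catTP h).toLinearMap (deltaIter R A X δ k) ∘ₗ deltaIter R A X δ j := by
  subst h
  induction k with
  | zero =>
    have : glue (catTP (rfl : j + 0 = j)).toLinearMap (deltaIter R A X δ 0) = LinearMap.id := by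
      refine TensorProduct.ext' fun u x => ?_
      simp [glue, deltaIter_zero_apply, catTP_empty]
    exact (congrArg (· ∘ₗ deltaIter R A X δ j) this).symm
  | succ k ih =>
    rw [deltaIter_succ δ k, glue_glue_comp]
    change deltaIter R A X δ ((j + k) + 1) = _
    rw [deltaIter_succ δ (j + k), ih, ← LinearMap.comp_assoc]
    congr 1
    have : glue (catTP (R := R) (A := A) (rfl : j + k = j + k)).toLinearMap (deltaIter R A X δ k) =
        rTensor X (catTP rfl).toLinearMap ∘ₗ glue LinearMap.id (deltaIter R A X δ k) := by
      rw [rTensor_comp_glue, LinearMap.comp_id]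
    rw [this, ← LinearMap.comp_assoc, glue_comp_rTensor]
    congr 2
    refine TensorProduct.ext_threefold fun u v a => ?_
    simpa using catTP_assoc _ _ _ _ u v ((oneEquivTP R A).symm a)

lemma deltaIter_cons {r m : ℕ} (h : 1 + r = m) :
    deltaIter R A X δ m =
      rTensor X (consTP h) ∘ₗ glue LinearMap.id (deltaIter R A X δ r) ∘ₗ δ := by
  rw [deltaIter_add δ h, deltaIter_one, ← LinearMap.comp_assoc, glue_comp_rTensor,
    ← LinearMap.comp_assoc, rTensor_comp_glue]
  rfl

lemma differential_deltaIter (dA : A →ₗ[R] A) {i r s n : ℕ} (hs : 1 + r = s) (hn : i + s = n)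
    (hi : i < n) :
    rTensor X (PiTensorProduct.map
        (Function.update (fun _ : Fin n => (LinearMap.id : A →ₗ[R] A)) ⟨i, hi⟩ dA)) ∘ₗ
        deltaIter R A X δ n =
      glue ((catTP hn).toLinearMap ∘ₗ lTensor (TP R A i) (consTP hs))
        (glue LinearMap.id (deltaIter R A X δ r) ∘ₗ (rTensor X dA ∘ₗ δ)) ∘ₗ
        deltaIter R A X δ i := by
  rw [deltaIter_add δ hn, deltaIter_cons δ hs, ← LinearMap.comp_assoc, rTensor_comp_glue,
    glue_rTensor_comp, LinearMap.comp_assoc, map_update_catTP, ← LinearMap.comp_assoc,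
    glue_comp_rTensor, LinearMap.id_comp, lTensor_comp, ← LinearMap.comp_assoc, ← glue_rTensor_comp,
    ← LinearMap.comp_assoc, rTensor_comp_glue, LinearMap.comp_id]

lemma contraction_deltaIter (mul : A →ₗ[R] A →ₗ[R] A) {i r s n : ℕ} (hs : 1 + r = s)
    (hn : i + s = n) (hi : i + 2 ≤ n + 1) :
    rTensor X (conTP R A mul (n + 1) i hi) ∘ₗ deltaIter R A X δ (n + 1) =
      glue ((catTP hn).toLinearMap ∘ₗ lTensor (TP R A i) (consTP hs))
        (glue LinearMap.id (deltaIter R A X δ r) ∘ₗ (rTensor X (TensorProduct.lift mul) ∘ₗ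
          (TensorProduct.assoc R A A X).symm.toLinearMap ∘ₗ lTensor A δ ∘ₗ δ)) ∘ₗ
        deltaIter R A X δ i := by
  have ht : 1 + s = s + 1 := by omega
  have hn₁ : i + (s + 1) = n + 1 := by omega
  have hδ : (TensorProduct.assoc R A A X).symm.toLinearMap ∘ₗ lTensor A δ =
      glue LinearMap.id δ := by
    simp [glue]
  have hF : glue (LinearMap.id : A ⊗[R] TP R A s →ₗ[R] A ⊗[R] TP R A s) (deltaIter R A X δ s) =
      rTensor X (lTensor A (consTP hs)) ∘ₗ
        glue (TensorProduct.assoc R A A (TP R A r)).toLinearMap (deltaIter R A X δ r) ∘ₗ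
        glue LinearMap.id δ := by
    rw [deltaIter_cons δ hs, glue_rTensor_comp, LinearMap.id_comp, glue_glue_comp,
      lTensor_id, LinearMap.id_comp, ← LinearMap.comp_assoc, rTensor_comp_glue]
  have hmul : rTensor X (rTensor (TP R A r) (TensorProduct.lift mul) ∘ₗ
        (TensorProduct.assoc R A A (TP R A r)).symm.toLinearMap) ∘ₗ
        glue (TensorProduct.assoc R A A (TP R A r)).toLinearMap (deltaIter R A X δ r) =
      glue LinearMap.id (deltaIter R A X δ r) ∘ₗ rTensor X (TensorProduct.lift mul) := by
    rw [rTensor_comp_glue, glue_comp_rTensor, LinearMap.id_comp, LinearMap.comp_assoc]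
    simp
  rw [deltaIter_add δ hn₁, deltaIter_cons δ ht, hF, ← LinearMap.comp_assoc, rTensor_comp_glue,
    LinearMap.comp_assoc, LinearMap.comp_assoc, glue_rTensor_comp, LinearMap.comp_assoc,
    glue_rTensor_comp, LinearMap.comp_assoc, LinearMap.comp_assoc, ← lTensor_comp,
    conTP_catTP mul hs ht hn₁ hn, lTensor_comp, ← LinearMap.comp_assoc, ← glue_rTensor_comp,
    ← LinearMap.comp_assoc, ← LinearMap.comp_assoc,
    hmul, LinearMap.comp_assoc, LinearMap.comp_assoc, ← hδ, LinearMap.comp_assoc]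

lemma add_self_eq_zero_of_charTwo (R : Type) [CommRing R] [CharP R 2] {V : Type} [AddCommGroup V]
    [Module R V] (v : V) : v + v = 0 := by
  rw [← two_smul R v, CharTwo.two_eq_zero, zero_smul]

lemma contraction_deltaIter_eq_differential [CharP R 2] (mul : A →ₗ[R] A →ₗ[R] A) (dA : A →ₗ[R] A)
    (hD : (rTensor X (TensorProduct.lift mul)) ∘ₗ
            (TensorProduct.assoc R A A X).symm.toLinearMap ∘ₗ (lTensor A δ) ∘ₗ δ
          + (rTensor X dA) ∘ₗ δ = 0) {i n : ℕ} (hi : i < n) (hi' : i + 2 ≤ n + 1) :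
    rTensor X (conTP R A mul (n + 1) i hi') ∘ₗ deltaIter R A X δ (n + 1) =
      rTensor X (PiTensorProduct.map
        (Function.update (fun _ : Fin n => (LinearMap.id : A →ₗ[R] A)) ⟨i, hi⟩ dA)) ∘ₗ
        deltaIter R A X δ n := by
  obtain ⟨r, rfl⟩ : ∃ r, n = i + (1 + r) := ⟨n - i - 1, by omega⟩
  have h : rTensor X (TensorProduct.lift mul) ∘ₗ
      (TensorProduct.assoc R A A X).symm.toLinearMap ∘ₗ lTensor A δ ∘ₗ δ = rTensor X dA ∘ₗ δ := by
    rw [eq_neg_of_add_eq_zero_left hD]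
    exact neg_eq_of_add_eq_zero_left (add_self_eq_zero_of_charTwo R _)
  rw [contraction_deltaIter δ mul rfl rfl, differential_deltaIter δ dA rfl rfl, h]

variable {M : Type} [AddCommGroup M] [Module R M] (mOp : (j : ℕ) → (M ⊗[R] TP R A j) →ₗ[R] M)

lemma glue_CtermTP_succ [CharP R 2] (mul : A →ₗ[R] A →ₗ[R] A) (dA : A →ₗ[R] A)
    (hD : (rTensor X (TensorProduct.lift mul)) ∘ₗ
            (TensorProduct.assoc R A A X).symm.toLinearMap ∘ₗ (lTensor A δ) ∘ₗ δ
          + (rTensor X dA) ∘ₗ δ = 0) (n : ℕ) :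
    glue (CtermTP R A M mul mOp (n + 1)) (deltaIter R A X δ (n + 1)) =
      glue (mOp n ∘ₗ lTensor M (dbarTP R A dA n)) (deltaIter R A X δ n) := by
  have hsum : mOp n ∘ₗ lTensor M (dbarTP R A dA n) = ∑ i : Fin n, mOp n ∘ₗ lTensor M
      (PiTensorProduct.map
        (Function.update (fun _ : Fin n => (LinearMap.id : A →ₗ[R] A)) i dA)) := by
    refine TensorProduct.ext' fun p u => ?_
    simp [dbarTP, LinearMap.sum_apply, tmul_sum]
  rw [hsum, CtermTP, glue_sum_left, glue_sum_left]
  refine Finset.sum_congr rfl fun i _ => ?_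
  have hi : i.val < n := i.isLt
  have hi' : i.val + 2 ≤ n + 1 := by omega
  change glue (mOp n ∘ₗ lTensor M (conTP R A mul (n + 1) i.val hi')) _ = _
  rw [← glue_rTensor_comp]
  erw [ contraction_deltaIter_eq_differential δ mul dA hD hi hi',
    glue_rTensor_comp]
  rfl

lemma boxTerm_comp_boxTerm {n j k : ℕ} (h : j + k = n) :
    boxTerm R A M X mOp δ k ∘ₗ boxTerm R A M X mOp δ j =
      glue (AinfTerm R A M mOp n j) (deltaIter R A X δ n) := by
  obtain rfl : k = n - j := by omega
  have hj : j ≤ n := by omega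
  change glue _ _ ∘ₗ glue _ _ = _
  rw [AinfTerm, dif_pos hj, deltaIter_add δ h, glue_glue_comp, splitAt_eq]
  rw [← LinearMap.comp_id (mOp j), ← rTensor_comp_glue, ← LinearMap.comp_assoc, glue_comp_rTensor,
    LinearMap.comp_id]
  congr 2
  refine TensorProduct.ext_threefold fun p u v => ?_
  simp

lemma sum_comp_sum_eq_sum_range_sum_range {V : Type} [AddCommGroup V] [Module R V]
    (f : ℕ → V →ₗ[R] V) {N : ℕ} (hf : ∀ j, N ≤ j → f j = 0) :
    (∑ j ∈ Finset.range (N + 1), f j) ∘ₗ (∑ j ∈ Finset.range (N + 1), f j) =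
      ∑ n ∈ Finset.range (2 * N + 1), ∑ j ∈ Finset.range (n + 1), f (n - j) ∘ₗ f j := by
  change (_ : Module.End R V) * _ = _
  rw [Finset.sum_mul_sum, ← Finset.sum_product',
    ← Finset.sum_fiberwise_of_maps_to (t := Finset.range (2 * N + 1)) (g := fun p => p.1 + p.2)]
  · refine Finset.sum_congr rfl fun n _ => ?_
    change _ = ∑ j ∈ Finset.range (n + 1), f (n - j) * f j
    rw [← Finset.Nat.sum_antidiagonal_eq_sum_range_succ (fun j k => f k * f j),
      ← Finset.sum_equiv (Equiv.prodComm ℕ ℕ) (s := Finset.HasAntidiagonal.antidiagonal n)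
        (t := Finset.HasAntidiagonal.antidiagonal n) (f := fun p => f p.1 * f p.2)
        (g := fun p => f p.2 * f p.1) (by simp [add_comm]) (fun _ _ => rfl)]
    refine Finset.sum_subset (fun p hp => ?_) fun p hp hp' => ?_
    · have := (Finset.mem_filter.1 hp).2
      exact Finset.HasAntidiagonal.mem_antidiagonal.2 this
    · simp only [Finset.HasAntidiagonal.mem_antidiagonal, Finset.mem_filter, Finset.mem_product,
        Finset.mem_range] at hp hp'
      rcases Nat.lt_or_ge p.1 N with h₁ | h₁
      · change f p.1 * f p.2 = 0
        rw [hf p.2 (by omega), mul_zero]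
      · change f p.1 * f p.2 = 0
        rw [hf p.1 h₁, zero_mul]
  · intro p hp
    simp only [Finset.mem_product, Finset.mem_range] at hp ⊢
    omega

end BoxTensor

open TensorProduct LinearMap in
/-- Let `A` be a differential graded algebra over a ground
ring `R` of characteristic `2` (a finite direct sum of copies of `F₂` in the
paper), let `M` be a strictly unital right `A∞`-module over `A` that is
bounded (`m_{j+1} = 0` for all `j ≥ N`), and let `(X, δ¹)` be a left type `D`
structure over `A`.  Define `δ^j : X → A^{⊗j} ⊗ X` by iterating `δ¹`, and
define `∂` on `M ⊗ X` by `∂(p ⊗ x) = Σ_j (m_{j+1} ⊗ id_X)(p ⊗ δ^j(x))` (a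
finite sum, by boundedness).  Then `∂ ∘ ∂ = 0`: the box tensor product
`M ⊠ X` is a chain complex.

Here `mOp j : M ⊗ A^{⊗j} → M` is the operation `m_{j+1}`; the `A∞`-structure
equation is `hAinf`; strict unitality is `hu₁`, `hu₂`; and the type `D`
structure equation is `hD`. -/
theorem box_tensor_product_is_complex
    (R : Type) [CommRing R] [CharP R 2]
    (A : Type) [AddCommGroup A] [Module R A]
    (mul : A →ₗ[R] A →ₗ[R] A) (dA : A →ₗ[R] A) (one : A)
    (hd2 : ∀ a : A, dA (dA a) = 0)
    (hLeib : ∀ a b : A, dA (mul a b) = mul (dA a) b + mul a (dA b))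
    (hassoc : ∀ a b c : A, mul (mul a b) c = mul a (mul b c))
    (honel : ∀ a : A, mul one a = a) (honer : ∀ a : A, mul a one = a)
    (hdone : dA one = 0)
    (M : Type) [AddCommGroup M] [Module R M]
    (mOp : (j : ℕ) → (M ⊗[R] TP R A j) →ₗ[R] M)
    (hAinf : ∀ n : ℕ,
      (∑ j ∈ Finset.range (n + 1), AinfTerm R A M mOp n j) +
        mOp n ∘ₗ lTensor M (dbarTP R A dA n) + CtermTP R A M mul mOp n = 0)
    (hu₁ : mOp 1 ∘ₗ lTensor M (insTP R A one 0 0 (le_refl 0)) =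
      (TensorProduct.rid R M).toLinearMap ∘ₗ lTensor M (emptyEquivTP R A).toLinearMap)
    (hu₂ : ∀ (n k : ℕ) (h : k ≤ n + 1),
      mOp (n + 2) ∘ₗ lTensor M (insTP R A one (n + 1) k h) = 0)
    (N : ℕ) (hbound : ∀ j : ℕ, N ≤ j → mOp j = 0)
    (X : Type) [AddCommGroup X] [Module R X]
    (δ : X →ₗ[R] A ⊗[R] X)
    (hD : (rTensor X (TensorProduct.lift mul)) ∘ₗ
            (TensorProduct.assoc R A A X).symm.toLinearMap ∘ₗ
            (lTensor A δ) ∘ₗ δ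
          + (rTensor X dA) ∘ₗ δ = 0) :
    (∑ j ∈ Finset.range (N + 1), boxTerm R A M X mOp δ j) ∘ₗ
      (∑ j ∈ Finset.range (N + 1), boxTerm R A M X mOp δ j) = 0 := by
  have hbox : ∀ j, N ≤ j → boxTerm R A M X mOp δ j = 0 := fun j hj => by
    simp [boxTerm, hbound j hj]
  rw [sum_comp_sum_eq_sum_range_sum_range _ hbox]
  set T : ℕ → (M ⊗[R] X) →ₗ[R] (M ⊗[R] X) := fun n =>
    glue (mOp n ∘ₗ lTensor M (dbarTP R A dA n)) (deltaIter R A X δ n) with hT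
  set S : ℕ → (M ⊗[R] X) →ₗ[R] (M ⊗[R] X) := fun n =>
    glue (CtermTP R A M mul mOp n) (deltaIter R A X δ n) with hS
  have hterm : ∀ n, ∑ j ∈ Finset.range (n + 1),
      boxTerm R A M X mOp δ (n - j) ∘ₗ boxTerm R A M X mOp δ j = T n + S n := fun n => by
    have h := congrArg (fun g => glue g (deltaIter R A X δ n)) (hAinf n)
    simp only [glue_add_left, glue_sum_left, glue_zero_left] at h
    rw [add_assoc] at h
    rw [Finset.sum_congr rfl fun j hj => boxTerm_comp_boxTerm δ mOp (n := n)
      (Nat.add_sub_cancel' (Nat.lt_succ_iff.1 (Finset.mem_range.1 hj))),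
      eq_neg_of_add_eq_zero_left h]
    exact neg_eq_of_add_eq_zero_left (add_self_eq_zero_of_charTwo R _)
  have hS0 : S 0 = 0 := by simp [hS, CtermTP, glue_zero_left]
  have hTN : T (2 * N) = 0 := by
    simp [hT, hbound (2 * N) (by omega), glue_zero_left]
  have hSucc : ∀ n, S (n + 1) = T n := glue_CtermTP_succ δ mOp mul dA hD
  rw [Finset.sum_congr rfl fun n _ => hterm n, Finset.sum_add_distrib, Finset.sum_range_succ,
    Finset.sum_range_succ' S, hTN, hS0, add_zero, add_zero, Finset.sum_congr rfl fun n _ => hSucc n]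
  exact add_self_eq_zero_of_charTwo R _
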